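/- arXiv:1510.09042 — 6 statements merged into one kernel-verified Lean document; each statement's English description precedes it below -/
import Mathlib

section
/- Let n ≥ 1, T > 0 and ħ > 0. Let H : ℝ → Matrix (Fin n) (Fin n) ℂ be continuous with H(t + T) = H(t) for all t ∈ ℝ, and let U : ℝ → Matrix (Fin n) (Fin n) ℂ satisfy U(0) = 1 and, for all t, U is differentiable at t with iħ·U'(t) = H(t)·U(t). Then for all t ∈ ℝ one has U(t + T) = U(t) * U(T). -/
section aux
attribute [local instance] Matrix.normedAddCommGroup Matrix.normedSpace

theorem lin_ode_unique_aux (n : ℕ) (H : ℝ → Matrix (Fin n) (Fin n) ℂ) (c : ℂ)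
    (Hcont : Continuous H) (f g : ℝ → Matrix (Fin n) (Fin n) ℂ)
    (hf : ∀ (t : ℝ) (i j : Fin n), HasDerivAt (fun s => f s i j) ((c • (H t * f t)) i j) t)
    (hg : ∀ (t : ℝ) (i j : Fin n), HasDerivAt (fun s => g s i j) ((c • (H t * g t)) i j) t)
    (h0 : f 0 = g 0) (t : ℝ) : f t = g t := by
  obtain ⟨C, hC⟩ := (isCompact_Icc (a := -|t| - 1) (b := |t| + 1)).exists_bound_of_continuousOn
    Hcont.continuousOn
  have hf' : ∀ t, HasDerivAt f (c • (H t * f t)) t := fun t =>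
    hasDerivAt_pi.2 fun i => hasDerivAt_pi.2 fun j => hf t i j
  have hg' : ∀ t, HasDerivAt g (c • (H t * g t)) t := fun t =>
    hasDerivAt_pi.2 fun i => hasDerivAt_pi.2 fun j => hg t i j
  have ht := abs_nonneg t
  have hC0 : 0 ≤ C := (norm_nonneg _).trans (hC 0 ⟨by linarith, by linarith⟩)
  have hv : ∀ s ∈ Set.Ioo (-|t| - 1) (|t| + 1),
      LipschitzOnWith (Real.toNNReal (‖c‖ * (n * C)))
        (fun A : Matrix (Fin n) (Fin n) ℂ => c • (H s * A)) Set.univ := by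
    intro s hs
    apply LipschitzOnWith.of_dist_le_mul
    intro A _ B _
    rw [dist_eq_norm, dist_eq_norm, Real.coe_toNNReal _ (by positivity), ← smul_sub,
      ← Matrix.mul_sub, norm_smul, mul_assoc]
    gcongr
    rw [Matrix.norm_le_iff (by positivity)]
    intro i j
    rw [Matrix.mul_apply]
    calc ‖∑ k, H s i k * (A - B) k j‖ ≤ ∑ k : Fin n, C * ‖A - B‖ := by
          apply norm_sum_le_of_le
          intro k _
          rw [norm_mul]
          gcongr
          · exact (Matrix.norm_entry_le_entrywise_sup_norm _).trans
              (hC s (Set.Ioo_subset_Icc_self hs))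
          · exact Matrix.norm_entry_le_entrywise_sup_norm _
      _ = n * C * ‖A - B‖ := by simp [mul_assoc]
  exact ODE_solution_unique_of_mem_Ioo (t₀ := 0)
    (v := fun s A => c • (H s * A)) (s := fun _ => Set.univ) hv
    ⟨by linarith, by linarith⟩ (fun s _ => ⟨hf' s, trivial⟩) (fun s _ => ⟨hg' s, trivial⟩) h0
    ⟨by linarith [neg_abs_le t], by linarith [le_abs_self t]⟩
end aux


/-- **Floquet theorem for the propagator.** If the Hamiltonian `H` is `T`-periodic, then
the time-evolution operator satisfies `U (t + T) = U t * U T`. -/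
theorem propagator_periodicity
    (n : ℕ) (hn : 1 ≤ n) (T hbar : ℝ) (hT : 0 < T) (hhbar : 0 < hbar)
    (H U U' : ℝ → Matrix (Fin n) (Fin n) ℂ)
    (Hcont : Continuous H)
    (Hper : ∀ t : ℝ, H (t + T) = H t)
    (hU0 : U 0 = 1)
    (hUderiv : ∀ (t : ℝ) (i j : Fin n), HasDerivAt (fun s => U s i j) (U' t i j) t)
    (hSchrod : ∀ t : ℝ, (Complex.I * (hbar : ℂ)) • U' t = H t * U t) :
    ∀ t : ℝ, U (t + T) = U t * U T := by

  have hc : Complex.I * (hbar : ℂ) ≠ 0 :=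
    mul_ne_zero Complex.I_ne_zero (by exact_mod_cast hhbar.ne')
  have hU' : ∀ t, U' t = (Complex.I * (hbar : ℂ))⁻¹ • (H t * U t) := fun t => by
    rw [← hSchrod t, smul_smul, inv_mul_cancel₀ hc, one_smul]
  refine lin_ode_unique_aux n H (Complex.I * (hbar : ℂ))⁻¹ Hcont (fun t => U (t + T))
    (fun t => U t * U T) ?_ ?_ (by simp [hU0])
  · intro t i j
    have h := (hUderiv (t + T) i j).comp_add_const t T
    rw [hU', Hper] at h
    exact h
  · intro t i j
    have h : HasDerivAt (fun s => ∑ k, U s i k * U T k j) (∑ k, U' t i k * U T k j) t :=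
      HasDerivAt.fun_sum fun k _ => (hUderiv t i k).mul_const _
    have e : ((Complex.I * (hbar : ℂ))⁻¹ • (H t * (U t * U T))) i j
        = ∑ k, U' t i k * U T k j := by
      rw [← Matrix.mul_assoc, ← Matrix.smul_mul, ← hU', Matrix.mul_apply]
    rw [e]
    simpa only [Matrix.mul_apply] using h
end

section
/- Let n ≥ 1, T > 0 and ħ > 0. Let H : ℝ → Matrix (Fin n) (Fin n) ℂ be continuous with H(t + T) = H(t) and H(t) Hermitian for all t, and let U be its propagator (U(0) = 1 and iħ·U'(t) = H(t)·U(t) for all t). Then there exist real numbers ε₁, …, εₙ (quasienergies) and continuous maps u₁, …, uₙ : ℝ → ℂⁿ with u_j(t + T) = u_j(t) for all t (T-periodic Floquet functions), such that (u₁(0), …, uₙ(0)) is an orthonormal basis of ℂⁿ, each Floquet state ψ_j(t) := exp(−i·ε_j·t/ħ)·u_j(t) is differentiable with iħ·ψ_j'(t) = H(t)·ψ_j(t), and for every w ∈ ℂⁿ and all t ∈ ℝ: U(t)·w = Σ_j ⟨u_j(0), w⟩ · exp(−i·ε_j·t/ħ) · u_j(t); in particular the expansion coefficients a_j = ⟨u_j(0),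 w⟩ do not depend on time. -/
open Matrix

lemma fl_unitary_diag {n : ℕ} (V : Matrix (Fin n) (Fin n) ℂ) (hV : Vᴴ * V = 1) :
    ∃ (v : Fin n → Fin n → ℂ) (μ : Fin n → ℂ),
      (∀ j l, star (v j) ⬝ᵥ v l = if j = l then (1 : ℂ) else 0) ∧
      (∀ w : Fin n → ℂ, w = ∑ j, (star (v j) ⬝ᵥ w) • v j) ∧
      (∀ j, V *ᵥ v j = μ j • v j) ∧ (∀ j, ‖μ j‖ = 1) := by
  have hV' : V * Vᴴ = 1 := mul_eq_one_comm.mp hV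
  -- a unimodular number outside the spectrum
  obtain ⟨c, hc1, hc2⟩ : ∃ c : ℂ, ‖c‖ = 1 ∧ V.charpoly.eval c ≠ 0 := by
    have hinf : (Set.range fun x : Circle => (x : ℂ)).Infinite := by
      have : Infinite Circle := by
        have h := Circle.argEquiv
        have : Infinite (Set.Ioc (-Real.pi) Real.pi) :=
          (Set.Ioc_infinite (by linarith [Real.pi_pos])).to_subtype
        exact Infinite.of_injective _ h.symm.injective
      exact Set.infinite_range_of_injective Circle.coe_injective
    obtain ⟨c, hc, hc'⟩ := hinf.exists_notMem_finset V.charpoly.roots.toFinset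
    obtain ⟨x, rfl⟩ := hc
    refine ⟨x, Circle.norm_coe x, fun h => hc' ?_⟩
    simpa [Polynomial.mem_roots, V.charpoly_monic.ne_zero] using h
  have hcc : star c * c = 1 := by
    have := Complex.conj_mul' c
    simpa [hc1] using this
  set S : Matrix (Fin n) (Fin n) ℂ := c • (1 : Matrix (Fin n) (Fin n) ℂ) - V with hS
  have hdet : IsUnit S.det := by
    rw [Matrix.eval_charpoly] at hc2
    rw [hS, isUnit_iff_ne_zero]
    convert hc2 using 3
    ext i j
    simp [Matrix.scalar_apply, Matrix.diagonal_apply, Matrix.one_apply]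
  have hSi : S * S⁻¹ = 1 := Matrix.mul_nonsing_inv S hdet
  have hiS : S⁻¹ * S = 1 := Matrix.nonsing_inv_mul S hdet
  set P : Matrix (Fin n) (Fin n) ℂ := c • (1 : Matrix (Fin n) (Fin n) ℂ) + V with hP
  set A : Matrix (Fin n) (Fin n) ℂ := Complex.I • (S⁻¹ * P) with hA
  have hSA : S * A = Complex.I • P := by
    rw [hA, Matrix.mul_smul, ← Matrix.mul_assoc, hSi, Matrix.one_mul]
  have hPS : P * Sᴴ = - (S * Pᴴ) := by
    simp only [hS, hP, conjTranspose_sub, conjTranspose_add, conjTranspose_smul,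
      conjTranspose_one, add_mul, mul_sub, sub_mul, mul_add, hV', Matrix.smul_mul, Matrix.mul_smul,
      Matrix.one_mul, Matrix.mul_one, smul_smul, hcc]
    rw [mul_comm] at hcc
    simp only [hcc, one_smul]
    abel
  have hAh : A.IsHermitian := by
    have h1 : S * A * Sᴴ = S * Aᴴ * Sᴴ := by
      rw [Matrix.mul_assoc S Aᴴ, ← conjTranspose_mul, hSA, conjTranspose_smul, Matrix.smul_mul, hPS,
        Matrix.mul_smul]
      simp
    have h2 : Sᴴ * (S⁻¹)ᴴ = 1 := by rw [← conjTranspose_mul, hiS, conjTranspose_one]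
    have h3 := congrArg (fun X => S⁻¹ * X * (S⁻¹)ᴴ) h1
    simp only [Matrix.mul_assoc, h2, Matrix.mul_one] at h3
    simp only [← Matrix.mul_assoc, hiS, Matrix.one_mul] at h3
    exact h3.symm
  let b := hAh.eigenvectorBasis
  let v : Fin n → Fin n → ℂ := fun j => (b j).ofLp
  let lam := hAh.eigenvalues
  have hav : ∀ j, A *ᵥ v j = (lam j : ℂ) • v j := fun j => by
    have := hAh.mulVec_eigenvectorBasis j
    simpa [v, b, lam] using this
  have horth : ∀ j l, star (v j) ⬝ᵥ v l = if j = l then (1 : ℂ) else 0 := fun j l => by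
    have := orthonormal_iff_ite.mp b.orthonormal j l
    rw [EuclideanSpace.inner_eq_star_dotProduct, dotProduct_comm] at this
    exact this
  have hne : ∀ j, (Complex.I + lam j : ℂ) ≠ 0 := fun j h => by
    have := congrArg Complex.im h
    simp at this
  have heig : ∀ j, V *ᵥ v j = (((lam j - Complex.I) * c) / (Complex.I + lam j)) • v j := fun j => by
    have h1 : S *ᵥ (A *ᵥ v j) = Complex.I • (P *ᵥ v j) := by
      rw [mulVec_mulVec, hSA, smul_mulVec]
    rw [hav, mulVec_smul, hS, hP, sub_mulVec, add_mulVec, smul_mulVec, one_mulVec] at h1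
    funext i
    have h2 := congrFun h1 i
    simp only [Pi.smul_apply, Pi.sub_apply, Pi.add_apply, smul_eq_mul] at h2 ⊢
    have := hne j
    field_simp
    linear_combination -h2
  refine ⟨v, fun j => ((lam j - Complex.I) * c) / (Complex.I + lam j), horth, ?_, heig, ?_⟩
  · intro w
    have := b.sum_repr' (WithLp.toLp 2 w)
    have h2 := congrArg WithLp.ofLp this
    simp only [EuclideanSpace.inner_eq_star_dotProduct] at h2
    rw [WithLp.ofLp_sum] at h2
    simp only [WithLp.ofLp_smul] at h2
    refine h2.symm.trans ?_
    refine Finset.sum_congr rfl fun j _ => ?_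
    rw [dotProduct_comm]
  · intro j
    have hn : ‖(lam j - Complex.I : ℂ)‖ = ‖(Complex.I + lam j : ℂ)‖ := by
      rw [← Complex.norm_conj]; congr 1; simp; ring
    rw [norm_div, norm_mul, hc1, mul_one, hn, div_self (norm_ne_zero_iff.mpr (hne j))]

lemma fl_const {n : ℕ} (k : ℂ) (hk : star k = -k) (H X X' Y Y' : ℝ → Matrix (Fin n) (Fin n) ℂ)
    (Hherm : ∀ t : ℝ, (H t).IsHermitian)
    (hX : ∀ (t : ℝ) (i j : Fin n), HasDerivAt (fun s => X s i j) (X' t i j) t)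
    (hY : ∀ (t : ℝ) (i j : Fin n), HasDerivAt (fun s => Y s i j) (Y' t i j) t)
    (hX' : ∀ t, X' t = k • (H t * X t)) (hY' : ∀ t, Y' t = k • (H t * Y t)) (t : ℝ) :
    (X t)ᴴ * Y t = (X 0)ᴴ * Y 0 := by
  ext i j
  have hd : ∀ t, HasDerivAt (fun s => ((X s)ᴴ * Y s) i j) 0 t := fun t => by
    have h0 : ((X' t)ᴴ * Y t + (X t)ᴴ * Y' t) i j = 0 := by
      rw [hX', hY', conjTranspose_smul, conjTranspose_mul, (Hherm t).eq, hk]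
      simp [Matrix.mul_assoc]
    rw [← h0]
    simp only [Matrix.add_apply, Matrix.mul_apply, conjTranspose_apply, ← Finset.sum_add_distrib]
    exact HasDerivAt.fun_sum fun l _ => ((hX t l i).star).mul (hY t l j)
  exact is_const_of_deriv_eq_zero (fun t => (hd t).differentiableAt) (fun t => (hd t).deriv) t 0


/-- **Completeness of the Floquet states.** For a `T`-periodic Hermitian Hamiltonian there
are quasienergies `ε j` and `T`-periodic Floquet functions `u j` whose values at `t = 0`
form an orthonormal basis of `ℂⁿ`, such that the Floquet states
`ψ j t = exp (-(i ε j t)/ħ) • u j t` solve the Schrödinger equation, and every solution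
`U t ·ᵥ w` expands in the Floquet states with time-independent coefficients
`a j = ⟨u j 0, w⟩`. -/
theorem floquet_state_expansion
    (n : ℕ) (hn : 1 ≤ n) (T hbar : ℝ) (hT : 0 < T) (hhbar : 0 < hbar)
    (H U U' : ℝ → Matrix (Fin n) (Fin n) ℂ)
    (Hcont : Continuous H)
    (Hper : ∀ t : ℝ, H (t + T) = H t)
    (Hherm : ∀ t : ℝ, (H t).IsHermitian)
    (hU0 : U 0 = 1)
    (hUderiv : ∀ (t : ℝ) (i j : Fin n), HasDerivAt (fun s => U s i j) (U' t i j) t)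
    (hSchrod : ∀ t : ℝ, (Complex.I * (hbar : ℂ)) • U' t = H t * U t) :
    ∃ (ε : Fin n → ℝ) (u : Fin n → ℝ → (Fin n → ℂ)) (dψ : Fin n → ℝ → (Fin n → ℂ)),
      -- the Floquet functions are continuous and `T`-periodic
      (∀ j, Continuous (u j)) ∧
      (∀ j (t : ℝ), u j (t + T) = u j t) ∧
      -- `(u 0 0, …, u (n-1) 0)` is an orthonormal basis of `ℂⁿ`
      (∀ j l, star (u j 0) ⬝ᵥ u l 0 = if j = l then (1 : ℂ) else 0) ∧
      (Submodule.span ℂ (Set.range fun j => u j 0) = ⊤) ∧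
      -- each Floquet state solves the Schrödinger equation
      (∀ j (t : ℝ),
        HasDerivAt (fun (s : ℝ) => Complex.exp (-(Complex.I * (ε j : ℂ) * (s : ℂ) / (hbar : ℂ))) • u j s)
          (dψ j t) t) ∧
      (∀ j (t : ℝ),
        (Complex.I * (hbar : ℂ)) • dψ j t
          = (H t) *ᵥ (Complex.exp (-(Complex.I * (ε j : ℂ) * (t : ℂ) / (hbar : ℂ))) • u j t)) ∧
      -- expansion of an arbitrary solution with time-independent coefficients
      (∀ (w : Fin n → ℂ) (t : ℝ),
        (U t) *ᵥ w
          = ∑ j, (star (u j 0) ⬝ᵥ w)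
              • (Complex.exp (-(Complex.I * (ε j : ℂ) * (t : ℂ) / (hbar : ℂ))) • u j t)) := by

  have hh : (hbar : ℂ) ≠ 0 := by exact_mod_cast hhbar.ne'
  have hTC : (T : ℂ) ≠ 0 := by exact_mod_cast hT.ne'
  have hI : Complex.I * (hbar : ℂ) ≠ 0 := mul_ne_zero Complex.I_ne_zero hh
  have hU' : ∀ t, U' t = (Complex.I * (hbar : ℂ))⁻¹ • (H t * U t) := fun t => by
    rw [← hSchrod, smul_smul, inv_mul_cancel₀ hI, one_smul]
  have hk : star (Complex.I * (hbar : ℂ))⁻¹ = -(Complex.I * (hbar : ℂ))⁻¹ := by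
    simp
  have hun : ∀ t, (U t)ᴴ * U t = 1 := fun t => by
    rw [fl_const _ hk H U U' U U' Hherm hUderiv hUderiv hU' hU' t, hU0]; simp
  have hsh : ∀ t, U (t + T) = U t * U T := fun t => by
    have h := fl_const _ hk H U U' (fun s => U (s + T)) (fun s => U' (s + T)) Hherm hUderiv
      (fun t i j => (hUderiv (t + T) i j).comp_add_const t T) hU'
      (fun t => by rw [hU' (t + T), Hper]) t
    simp only [hU0, zero_add, conjTranspose_one, Matrix.one_mul] at h
    rw [← h, ← Matrix.mul_assoc, mul_eq_one_comm.mp (hun t), Matrix.one_mul]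
  obtain ⟨v, μ, horth, hexp, heig, hμ⟩ := fl_unitary_diag (U T) (hun T)
  have hD : ∀ j t, HasDerivAt (fun s => U s *ᵥ v j) (U' t *ᵥ v j) t := fun j t => by
    rw [hasDerivAt_pi]
    intro i
    simp only [mulVec, dotProduct]
    exact HasDerivAt.fun_sum fun l _ => (hUderiv t i l).mul_const _
  let ε : Fin n → ℝ := fun j => -(hbar / T * (μ j).arg)
  let u : Fin n → ℝ → Fin n → ℂ := fun j t =>
    Complex.exp (Complex.I * (ε j : ℂ) * (t : ℂ) / (hbar : ℂ)) • (U t *ᵥ v j)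
  have hu0 : ∀ j, u j 0 = v j := fun j => by simp [u, hU0]
  have hψ : ∀ j (t : ℝ), Complex.exp (-(Complex.I * (ε j : ℂ) * (t : ℂ) / (hbar : ℂ))) • u j t
      = U t *ᵥ v j := fun j t => by
    simp only [u]
    rw [smul_smul, ← Complex.exp_add, neg_add_cancel, Complex.exp_zero, one_smul]
  have hμe : ∀ j, Complex.exp (Complex.I * (ε j : ℂ) * (T : ℂ) / (hbar : ℂ)) * μ j = 1 := fun j => by
    have h1 : μ j = Complex.exp ((μ j).arg * Complex.I) := by
      have := Complex.norm_mul_exp_arg_mul_I (μ j)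
      rw [hμ, Complex.ofReal_one, one_mul] at this
      exact this.symm
    have h2 : Complex.I * (ε j : ℂ) * (T : ℂ) / (hbar : ℂ) = -((μ j).arg * Complex.I) := by
      simp only [ε]
      push_cast
      field_simp
    rw [h2]
    nth_rewrite 2 [h1]
    rw [← Complex.exp_add, neg_add_cancel, Complex.exp_zero]
  refine ⟨ε, u, fun j t => U' t *ᵥ v j, ?_, ?_, ?_, ?_, ?_, ?_, ?_⟩
  · intro j
    have h1 : Continuous fun s => U s *ᵥ v j :=
      continuous_iff_continuousAt.mpr fun t => (hD j t).continuousAt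
    have h2 : Continuous fun t : ℝ =>
        Complex.exp (Complex.I * (ε j : ℂ) * (t : ℂ) / (hbar : ℂ)) := by fun_prop
    exact h2.smul h1
  · intro j t
    simp only [u]
    rw [hsh, ← mulVec_mulVec, heig, mulVec_smul, smul_smul]
    congr 1
    have : Complex.I * (ε j : ℂ) * ((t + T : ℝ) : ℂ) / (hbar : ℂ)
        = Complex.I * (ε j : ℂ) * (t : ℂ) / (hbar : ℂ)
          + Complex.I * (ε j : ℂ) * (T : ℂ) / (hbar : ℂ) := by push_cast; ring
    rw [this, Complex.exp_add, mul_assoc, hμe, mul_one]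
  · intro j l
    rw [hu0, hu0, horth]
  · rw [eq_top_iff]
    intro w _
    rw [hexp w]
    refine Submodule.sum_mem _ fun j _ => Submodule.smul_mem _ _ (Submodule.subset_span ⟨j, hu0 j⟩)
  · intro j t
    simp only [hψ]
    exact hD j t
  · intro j t
    rw [hψ, mulVec_mulVec, ← hSchrod, smul_mulVec]
  · intro w t
    simp only [hψ, hu0]
    conv_lhs => rw [hexp w]
    rw [mulVec_sum]
    simp only [mulVec_smul]
end

section
/- Let n ≥ 1, T > 0 and ħ > 0. Let H : ℝ → Matrix (Fin n) (Fin n) ℂ be continuous with H(t + T) = H(t) for all t, and let U be its propagator (U(0) = 1 and iħ·U'(t) = H(t)·U(t) for all t). If v ∈ ℂⁿ is an eigenvector of the one-cycle (monodromy) operator, U(T)·v = λ·v for some λ ∈ ℂ, then the solution ψ(t) := U(t)·v of the Schrödinger equation reproduces itself up to the Floquet multiplier λ after each period: ψ(t + T) = λ·ψ(t) for all t ∈ ℝ. -/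
open Matrix

/-- **Floquet multipliers.** If `v` is an eigenvector of the monodromy operator `U T` with
eigenvalue `λ`, then the solution `ψ t = U t ·ᵥ v` reproduces itself up to the Floquet
multiplier `λ` after each period. -/
theorem floquet_multiplier_reproduction
    (n : ℕ) (hn : 1 ≤ n) (T hbar : ℝ) (hT : 0 < T) (hhbar : 0 < hbar)
    (H U U' : ℝ → Matrix (Fin n) (Fin n) ℂ)
    (Hcont : Continuous H)
    (Hper : ∀ t : ℝ, H (t + T) = H t)
    (hU0 : U 0 = 1)
    (hUderiv : ∀ (t : ℝ) (i j : Fin n), HasDerivAt (fun s => U s i j) (U' t i j) t)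
    (hSchrod : ∀ t : ℝ, (Complex.I * (hbar : ℂ)) • U' t = H t * U t)
    (v : Fin n → ℂ) (lam : ℂ)
    (hv : (U T) *ᵥ v = lam • v) :
    ∀ t : ℝ, (U (t + T)) *ᵥ v = lam • ((U t) *ᵥ v) := by
  have hc : Complex.I * (hbar : ℂ) ≠ 0 :=
    mul_ne_zero Complex.I_ne_zero (by exact_mod_cast hhbar.ne')
  set c : ℂ := Complex.I * (hbar : ℂ) with hcdef
  have hU' : ∀ t, U' t = c⁻¹ • (H t * U t) := by
    intro t
    rw [← hSchrod t, smul_smul, inv_mul_cancel₀ hc, one_smul]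
  have hψ : ∀ t, HasDerivAt (fun s => U s *ᵥ v) (c⁻¹ • (H t *ᵥ (U t *ᵥ v))) t := by
    intro t
    have e : c⁻¹ • (H t *ᵥ (U t *ᵥ v)) = U' t *ᵥ v := by
      rw [hU' t, Matrix.smul_mulVec, Matrix.mulVec_mulVec]
    rw [e, hasDerivAt_pi]
    intro i
    simp only [Matrix.mulVec, dotProduct]
    exact HasDerivAt.fun_sum fun j _ => (hUderiv t i j).mul_const (v j)
  intro t
  have hbound : ∃ K : NNReal, ∀ s ∈ Set.Icc (-(|t| + 1)) (|t| + 1),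
      LipschitzWith K (fun x : Fin n → ℂ => c⁻¹ • (H s *ᵥ x)) := by
    letI : NormedAddCommGroup (Matrix (Fin n) (Fin n) ℂ) := Matrix.linftyOpNormedAddCommGroup
    obtain ⟨C, hC⟩ := (isCompact_Icc (a := -(|t| + 1)) (b := |t| + 1)).exists_bound_of_continuousOn
      (f := H) Hcont.continuousOn
    refine ⟨(‖c⁻¹‖ * C).toNNReal, fun s hs => LipschitzWith.of_dist_le_mul fun x y => ?_⟩
    rw [dist_eq_norm, dist_eq_norm, ← smul_sub, ← Matrix.mulVec_sub, norm_smul]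
    have h1 := Matrix.linfty_opNorm_mulVec (H s) (x - y)
    have h2 : ‖c⁻¹‖ * ‖H s *ᵥ (x - y)‖ ≤ ‖c⁻¹‖ * C * ‖x - y‖ := by
      rw [mul_assoc]
      refine mul_le_mul_of_nonneg_left (h1.trans ?_) (norm_nonneg _)
      exact mul_le_mul_of_nonneg_right (hC s hs) (norm_nonneg _)
    exact h2.trans (mul_le_mul_of_nonneg_right (Real.le_coe_toNNReal _) (norm_nonneg _))
  obtain ⟨K, hK⟩ := hbound
  have ht : t ∈ Set.Ioo (-(|t| + 1)) (|t| + 1) :=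
    ⟨by linarith [neg_abs_le t], by linarith [le_abs_self t]⟩
  have h0 : (0 : ℝ) ∈ Set.Ioo (-(|t| + 1)) (|t| + 1) :=
    ⟨by linarith [abs_nonneg t], by linarith [abs_nonneg t]⟩
  refine ODE_solution_unique_of_mem_Ioo (v := fun s x => c⁻¹ • (H s *ᵥ x)) (K := K)
    (s := fun _ => Set.univ) (f := fun s => U (s + T) *ᵥ v) (g := fun s => lam • (U s *ᵥ v))
    (fun s hs => (hK s (Set.Ioo_subset_Icc_self hs)).lipschitzOnWith) h0 ?_ ?_ ?_ ht
  · intro s _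
    refine ⟨?_, Set.mem_univ _⟩
    have h := (hψ (s + T)).comp_add_const s T
    rw [Hper] at h
    exact h
  · intro s _
    refine ⟨?_, Set.mem_univ _⟩
    have h := (hψ s).const_smul lam
    simp only [Matrix.mulVec_smul]
    rw [smul_comm]
    exact h
  · simp [hU0, hv]
end

section
/- Let ħ > 0 and ω₀, ω, μ, F ∈ ℝ. The quasienergies of the circularly driven two-level system are the eigenvalues of G_c := (ħω/2)·1 + (ħ/2)(ω₀ − ω)·σ_z + (μF/2)·σ_x: the spectrum of the 2×2 Hermitian matrix G_c equals {ħ(ω + Ω)/2, ħ(ω − Ω)/2}, where Ω := Real.sqrt((ω₀ − ω)² + (μF/ħ)²) is the generalized Rabi frequency. -/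
open Matrix

/-- Pauli matrix σ_x. -/
def sigmaX : Matrix (Fin 2) (Fin 2) ℂ := !![0, 1; 1, 0]
/-- Pauli matrix σ_z. -/
def sigmaZ : Matrix (Fin 2) (Fin 2) ℂ := !![1, 0; 0, -1]

/-- **Quasienergies of the circularly driven two-level system.** The spectrum of the
rotating-frame operator `G_c = (ħω/2)·1 + (ħ/2)(ω₀ − ω)·σ_z + (μF/2)·σ_x` equals
`{ħ(ω + Ω)/2, ħ(ω − Ω)/2}` with the generalized Rabi frequency
`Ω = √((ω₀ − ω)² + (μF/ħ)²)`. -/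
theorem quasienergies_circular_drive
    (hbar : ℝ) (hhbar : 0 < hbar) (ω₀ ω μ F : ℝ) :
    spectrum ℂ
        (((hbar * ω / 2 : ℝ) : ℂ) • (1 : Matrix (Fin 2) (Fin 2) ℂ)
          + ((hbar / 2 * (ω₀ - ω) : ℝ) : ℂ) • sigmaZ
          + ((μ * F / 2 : ℝ) : ℂ) • sigmaX)
      = {((hbar * (ω + Real.sqrt ((ω₀ - ω) ^ 2 + (μ * F / hbar) ^ 2)) / 2 : ℝ) : ℂ),
         ((hbar * (ω - Real.sqrt ((ω₀ - ω) ^ 2 + (μ * F / hbar) ^ 2)) / 2 : ℝ) : ℂ)} := by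
  have hS : hbar ^ 2 * (Real.sqrt ((ω₀ - ω) ^ 2 + (μ * F / hbar) ^ 2)) ^ 2
      = hbar ^ 2 * (ω₀ - ω) ^ 2 + (μ * F) ^ 2 := by
    rw [Real.sq_sqrt (by positivity)]
    field_simp
  generalize Real.sqrt ((ω₀ - ω) ^ 2 + (μ * F / hbar) ^ 2) = S at hS ⊢
  have hC : (hbar : ℂ) ^ 2 * (S : ℂ) ^ 2
      = (hbar : ℂ) ^ 2 * ((ω₀ : ℂ) - ω) ^ 2 + ((μ : ℂ) * F) ^ 2 := by
    exact_mod_cast hS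
  ext r
  rw [spectrum.mem_iff, Matrix.isUnit_iff_isUnit_det, isUnit_iff_ne_zero, not_not,
    Matrix.det_fin_two, Set.mem_insert_iff, Set.mem_singleton_iff,
    ← sub_eq_zero (a := r), ← sub_eq_zero (a := r) (b := Complex.ofReal (hbar * (ω - S) / 2)),
    ← mul_eq_zero]
  simp [sigmaX, sigmaZ, Matrix.algebraMap_matrix_apply, -mul_eq_zero]
  apply Eq.congr _ rfl
  linear_combination (1 / 4 : ℂ) * hC
end

section
/- Let ħ > 0, ω > 0 and E_c, W₀, k, a, z ∈ ℝ, and set T := 2π/ω. Define the instantaneous single-band energy h(t) := E_c − (W₀/2)·cos(k·a + z·sin(ωt)) and ψ(t) := exp(−(i/ħ)·∫₀ᵗ h(s) ds). Then ψ solves the scalar Schrödinger equation iħ·ψ'(t) = h(t)·ψ(t) with ψ(0) = 1, and the one-cycle Floquet multiplier is ψ(T) = exp(−(i/ħ)·ε·T) with quasienergy ε = E_c − (W₀/2)·cos(k·a)·((1/(2π))·∫ θ in (0)..(2π), cos(z·sin θ) dθ). In particular, the quasienergy band of a sinusoidally driven ideal cosine band E₀(k) = E_c − (W₀/2)cos(ka)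 is ε₀(k) = E_c − (W₀/2)·J₀(z)·cos(ka), which is dispersionless (flat in k) precisely when the Bessel-type average (1/(2π))∫₀^{2π}cos(z sin θ)dθ vanishes. -/
/-- The odd average vanishes. -/
theorem integral_sin_mul_sin_zero (z : ℝ) :
    ∫ θ in (0:ℝ)..(2 * Real.pi), Real.sin (z * Real.sin θ) = 0 := by
  have h := intervalIntegral.integral_comp_sub_left (a := 0) (b := 2 * Real.pi)
    (fun θ => Real.sin (z * Real.sin θ)) (2 * Real.pi)
  simp only [Real.sin_two_pi_sub, mul_neg, Real.sin_neg, intervalIntegral.integral_neg,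
    sub_self, sub_zero] at h
  linarith

theorem integral_cos_add_mul_sin (c z : ℝ) :
    ∫ θ in (0:ℝ)..(2 * Real.pi), Real.cos (c + z * Real.sin θ)
      = Real.cos c * ∫ θ in (0:ℝ)..(2 * Real.pi), Real.cos (z * Real.sin θ) := by
  simp only [Real.cos_add]
  rw [intervalIntegral.integral_sub, intervalIntegral.integral_const_mul,
    intervalIntegral.integral_const_mul, integral_sin_mul_sin_zero]
  · ring
  · exact Continuous.intervalIntegrable (by fun_prop) _ _
  · exact Continuous.intervalIntegrable (by fun_prop) _ _

/-- **Quasienergy of a sinusoidally driven ideal cosine band.** The phase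
`ψ t = exp(−(i/ħ)∫₀ᵗ h)` solves `iħψ' = h(t)ψ` with `ψ 0 = 1`, and the one-cycle Floquet
multiplier is `ψ T = exp(−(i/ħ) ε T)` with quasienergy
`ε = E_c − (W₀/2) cos(ka) · (1/(2π)) ∫₀^{2π} cos (z sin θ) dθ`,
i.e. the driven band is `ε₀(k) = E_c − (W₀/2) J₀(z) cos(ka)`. -/
theorem single_band_quasienergy
    (hbar ω : ℝ) (hhbar : 0 < hbar) (hω : 0 < ω)
    (Ec W₀ k a z : ℝ) :
    let T : ℝ := 2 * Real.pi / ω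
    let h : ℝ → ℝ := fun t => Ec - W₀ / 2 * Real.cos (k * a + z * Real.sin (ω * t))
    let ψ : ℝ → ℂ := fun t =>
      Complex.exp (-(Complex.I / (hbar : ℂ)) * ((∫ s in (0:ℝ)..t, h s : ℝ) : ℂ))
    let ε : ℝ := Ec - W₀ / 2 * Real.cos (k * a) *
      ((1 / (2 * Real.pi)) * ∫ θ in (0:ℝ)..(2 * Real.pi), Real.cos (z * Real.sin θ))
    ψ 0 = 1 ∧
    (∀ t : ℝ, HasDerivAt ψ ((-(Complex.I) / (hbar : ℂ) * (h t : ℂ)) * ψ t) t ∧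
      (Complex.I * (hbar : ℂ)) * ((-(Complex.I) / (hbar : ℂ) * (h t : ℂ)) * ψ t)
        = (h t : ℂ) * ψ t) ∧
    ψ T = Complex.exp (-(Complex.I / (hbar : ℂ)) * (ε : ℂ) * (T : ℂ)) := by
  intro T h ψ ε
  have hb : (hbar : ℂ) ≠ 0 := by exact_mod_cast hhbar.ne'
  have hc : Continuous h := by
    simp only [h]
    fun_prop
  refine ⟨by simp [ψ], fun t => ⟨?_, ?_⟩, ?_⟩
  · have h1 : HasDerivAt (fun t => ∫ s in (0:ℝ)..t, h s) (h t) t :=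
      intervalIntegral.integral_hasDerivAt_right (hc.intervalIntegrable _ _)
        (hc.stronglyMeasurableAtFilter _ _) hc.continuousAt
    have h2 := ((h1.ofReal_comp).const_mul (-(Complex.I / (hbar : ℂ)))).cexp
    refine h2.congr_deriv ?_
    simp only [ψ]
    ring
  · field_simp
    linear_combination (-(h t : ℂ) * ψ t) * Complex.I_sq
  · have key : ∫ s in (0:ℝ)..T, h s = ε * T := by
      have h3 : ∫ s in (0:ℝ)..T, Real.cos (k * a + z * Real.sin (ω * s))
          = ω⁻¹ * (Real.cos (k * a) *
            ∫ θ in (0:ℝ)..(2 * Real.pi), Real.cos (z * Real.sin θ)) := by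
        have h4 := intervalIntegral.integral_comp_mul_left (a := 0) (b := T)
          (fun θ => Real.cos (k * a + z * Real.sin θ)) hω.ne'
        have h5 : ω * T = 2 * Real.pi := by
          simp only [T]
          field_simp
        rw [h4, h5, mul_zero, integral_cos_add_mul_sin, smul_eq_mul]
      simp only [h]
      rw [intervalIntegral.integral_sub, intervalIntegral.integral_const_mul, h3,
        intervalIntegral.integral_const]
      · simp only [ε, T, smul_eq_mul, sub_zero]
        have := Real.pi_pos.ne'
        field_simp
      · exact Continuous.intervalIntegrable (by fun_prop) _ _
      · exact Continuous.intervalIntegrable (by fun_prop) _ _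
    simp only [ψ]
    rw [key]
    push_cast
    rw [mul_assoc]
end

section
/- Let n ≥ 1 and ħ > 0. Let H : ℝ → Matrix (Fin n) (Fin n) ℂ be continuous with H(t) Hermitian for all t, let S ∈ Matrix (Fin n) (Fin n) ℂ be a real symmetric involution (S·S = 1, Sᵀ = S, and S has real entries, e.g. the diagonal parity matrix with entries (−1)^μ), and assume the spatio-temporal symmetry S * (H(π − t)).map(starRingEnd ℂ) * S = H(t) for all t ∈ ℝ (entrywise complex conjugation of H(π − t)). Let U be the propagator (U(0) = 1 and iħ·U'(t) = H(t)·U(t) for all t). Then the evolution over the second quarter cycle is determined by that over the first: U(π) * (U(π/2))⁻¹ = S * (U(π/2))ᵀ * S; equivalently, in components, Ũ(π, π/2)_{μν} = (−1)^{μ+ν}·Ũ(π/2, 0)_{νμ} when S = diag((−1)^μ). -/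
open Matrix

lemma entry_mul {n : ℕ} {A B A' B' : ℝ → Matrix (Fin n) (Fin n) ℂ}
    (hA : ∀ (t : ℝ) (i j : Fin n), HasDerivAt (fun s => A s i j) (A' t i j) t)
    (hB : ∀ (t : ℝ) (i j : Fin n), HasDerivAt (fun s => B s i j) (B' t i j) t) :
    ∀ (t : ℝ) (i j : Fin n),
      HasDerivAt (fun s => (A s * B s) i j) ((A' t * B t + A t * B' t) i j) t := by
  intro t i j
  simp only [Matrix.add_apply, Matrix.mul_apply, ← Finset.sum_add_distrib]
  exact HasDerivAt.fun_sum fun k _ => (hA t i k).mul (hB t k j)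

lemma entry_const {n : ℕ} {A A' : ℝ → Matrix (Fin n) (Fin n) ℂ}
    (hA : ∀ (t : ℝ) (i j : Fin n), HasDerivAt (fun s => A s i j) (A' t i j) t)
    (h0 : ∀ t, A' t = 0) (x y : ℝ) : A x = A y := by
  ext i j
  refine is_const_of_deriv_eq_zero (f := fun s => A s i j)
    (fun t => (hA t i j).differentiableAt) (fun t => ?_) x y
  rw [(hA t i j).deriv, h0]; rfl


/-- **Quarter-cycle symmetry of the propagator.** If the Hamiltonian obeys the
spatio-temporal symmetry `S · conj (H (π − t)) · S = H t` with `S` a real symmetric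
involution, then the evolution over the second quarter cycle is determined by the first:
`U π * (U (π/2))⁻¹ = S * (U (π/2))ᵀ * S`. -/
theorem quarter_cycle_symmetry
    (n : ℕ) (hn : 1 ≤ n) (hbar : ℝ) (hhbar : 0 < hbar)
    (H U U' : ℝ → Matrix (Fin n) (Fin n) ℂ)
    (Hcont : Continuous H)
    (Hherm : ∀ t : ℝ, (H t).IsHermitian)
    (S : Matrix (Fin n) (Fin n) ℂ)
    (hSinv : S * S = 1)
    (hSsymm : Sᵀ = S)
    (hSreal : S.map (starRingEnd ℂ) = S)
    (hsym : ∀ t : ℝ, S * (H (Real.pi - t)).map (starRingEnd ℂ) * S = H t)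
    (hU0 : U 0 = 1)
    (hUderiv : ∀ (t : ℝ) (i j : Fin n), HasDerivAt (fun s => U s i j) (U' t i j) t)
    (hSchrod : ∀ t : ℝ, (Complex.I * (hbar : ℂ)) • U' t = H t * U t) :
    U Real.pi * (U (Real.pi / 2))⁻¹ = S * (U (Real.pi / 2))ᵀ * S := by
  obtain ⟨c, hc⟩ : ∃ c : ℂ, c = (Complex.I * (hbar : ℂ))⁻¹ := ⟨_, rfl⟩
  have hne : Complex.I * (hbar : ℂ) ≠ 0 :=
    mul_ne_zero Complex.I_ne_zero (by exact_mod_cast hhbar.ne')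
  have hcs : star c = -c := by
    rw [hc]; simp
  have hU' : ∀ t, U' t = c • (H t * U t) := by
    intro t
    rw [← hSchrod t, smul_smul, hc, inv_mul_cancel₀ hne, one_smul]
  have hunit : ∀ t, (U t)ᴴ * U t = 1 := by
    intro t
    have hd : ∀ (t : ℝ) (i j : Fin n),
        HasDerivAt (fun s => (U s)ᴴ i j) ((U' t)ᴴ i j) t := fun t i j => by
      simpa only [Matrix.conjTranspose_apply] using (hUderiv t j i).star
    have h := entry_const (A := fun s => (U s)ᴴ * U s) (entry_mul hd hUderiv) (fun t => by
      rw [hU', Matrix.conjTranspose_smul, Matrix.conjTranspose_mul, (Hherm t).eq, hcs]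
      simp [Matrix.mul_assoc]) t 0
    simpa [hU0] using h
  have hT : ∀ t, (H (Real.pi - t))ᵀ = S * H t * S := by
    intro t
    have h1 : (H (Real.pi - t)).map (starRingEnd ℂ) = (H (Real.pi - t))ᵀ := by
      conv_rhs => rw [← (Hherm (Real.pi - t)).eq]
      ext i j; simp
    rw [← hsym t, h1]
    calc _ = 1 * (H (Real.pi - t))ᵀ * 1 := by simp
      _ = _ := by rw [← hSinv]; simp only [Matrix.mul_assoc]
  have hd1 : ∀ (t : ℝ) (i j : Fin n),
      HasDerivAt (fun s => (U (Real.pi - s))ᵀ i j) ((-(U' (Real.pi - t))ᵀ) i j) t := by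
    intro t i j
    have := HasDerivAt.comp_const_sub Real.pi t (hUderiv (Real.pi - t) j i)
    simpa using this
  have hd2 : ∀ (t : ℝ) (i j : Fin n),
      HasDerivAt (fun _ : ℝ => S i j) ((0 : Matrix (Fin n) (Fin n) ℂ) i j) t :=
    fun t i j => hasDerivAt_const t _
  have hQ := entry_const (A := fun s => (U (Real.pi - s))ᵀ * S * U s)
    (entry_mul (entry_mul (A' := fun t => -(U' (Real.pi - t))ᵀ) (B := fun _ => S)
      (B' := fun _ => 0) hd1 hd2) hUderiv) (fun t => by
      have e : S * (S * (U t)) = U t := by rw [← Matrix.mul_assoc, hSinv, one_mul]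
      have e' : S * (S * (H t * U t)) = H t * U t := by
        rw [← Matrix.mul_assoc, hSinv, one_mul]
      rw [hU', hU', Matrix.transpose_smul, Matrix.transpose_mul, hT]
      simp [Matrix.mul_assoc, e, e']) 0 (Real.pi / 2)
  simp only [sub_zero, hU0, mul_one, sub_half] at hQ
  have hQ2 := congrArg Matrix.transpose hQ
  simp only [Matrix.transpose_mul, Matrix.transpose_transpose, hSsymm] at hQ2
  have hinv : U (Real.pi / 2) * (U (Real.pi / 2))⁻¹ = 1 := by
    rw [Matrix.inv_eq_left_inv (hunit _)]
    exact mul_eq_one_comm.mp (hunit _)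
  have hfin : U Real.pi = S * ((U (Real.pi / 2))ᵀ * (S * U (Real.pi / 2))) := by
    rw [← hQ2, ← Matrix.mul_assoc, hSinv, one_mul]
  rw [hfin]
  simp only [Matrix.mul_assoc, hinv, mul_one]
end
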